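/- arXiv:2010.09775 — 2 statements merged into one kernel-verified Lean document; each statement's English description precedes it below -/
import Mathlib

section
/- Let M_n be a uniformly random n × n matrix over F₂. For every fixed natural number m, the probability that M_n has corank m (i.e., rank M_n = n − m) converges as n → ∞ to [∏_{k=1}^{∞} (1 − 2^{−(m+k)})²] / [2^{m²} ∏_{k=1}^{∞} (1 − 2^{−k})]. -/
open Filter

open Module in
/-- Adjoining a vector outside a finite-dimensional subspace raises the dimension by one. -/
theorem finrank_span_singleton_sup {K V : Type*} [Field K] [AddCommGroup V] [Module K V]
    [FiniteDimensional K V] {S : Submodule K V} {x : V} (hx : x ∉ S) :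
    finrank K ↥(Submodule.span K {x} ⊔ S) = finrank K S + 1 := by
  have hx0 : x ≠ 0 := fun h => hx (h ▸ S.zero_mem)
  have hinf : Submodule.span K {x} ⊓ S = ⊥ :=
    ((Submodule.disjoint_span_singleton' hx0).2 hx).symm.eq_bot
  have h := Submodule.finrank_sup_add_finrank_inf_eq (Submodule.span K {x}) S
  rw [hinf, finrank_bot, finrank_span_singleton hx0] at h
  omega

section RankCount

variable {K V : Type*} [Field K] [AddCommGroup V] [Module K V] [Fintype V]

open Module

variable (K V) in
open scoped Classical in
/-- The number of `k`-tuples of vectors of `V` whose span has dimension `r`. -/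
noncomputable def rankCount (k r : ℕ) : ℤ :=
  ∑ s : Fin k → V, if finrank K ↥(Submodule.span K (Set.range s)) = r then 1 else 0

theorem rankCount_zero (r : ℕ) : rankCount K V 0 r = if r = 0 then 1 else 0 := by
  rw [rankCount, Fintype.sum_unique, Set.range_eq_empty, Submodule.span_empty, finrank_bot]
  simp only [eq_comm]

variable [Fintype K]

open scoped Classical in
/-- The number of vectors that bring a given subspace to dimension `r`. -/
theorem sum_ite_finrank_span_singleton_sup (S : Submodule K V) (r : ℕ) :
    (∑ x : V, if finrank K ↥(Submodule.span K {x} ⊔ S) = r then (1 : ℤ) else 0) =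
      (if finrank K S = r then (Fintype.card K : ℤ) ^ r else 0) +
      (if finrank K S + 1 = r then
        (Fintype.card K : ℤ) ^ finrank K V - (Fintype.card K : ℤ) ^ (r - 1) else 0) := by
  have hterm : ∀ x : V,
      (if finrank K ↥(Submodule.span K {x} ⊔ S) = r then (1 : ℤ) else 0) =
        (if finrank K S + 1 = r then 1 else 0) +
        (if x ∈ S then
          (if finrank K S = r then 1 else 0) - (if finrank K S + 1 = r then 1 else 0) else 0) := by
    intro x
    by_cases hx : x ∈ S
    · rw [sup_eq_right.2 ((Submodule.span_singleton_le_iff_mem x S).2 hx)]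
      simp [hx]
    · rw [finrank_span_singleton_sup hx]
      simp [hx]
  have hcard : ((Finset.univ.filter (· ∈ S)).card : ℤ) =
      (Fintype.card K : ℤ) ^ finrank K S := by
    rw [← Fintype.card_subtype]
    exact_mod_cast Module.card_eq_pow_finrank (K := K) (V := S)
  rw [Finset.sum_congr rfl fun x _ => hterm x, Finset.sum_add_distrib, Finset.sum_const,
    ← Finset.sum_filter, Finset.sum_const, nsmul_eq_mul, nsmul_eq_mul, hcard, Finset.card_univ,
    Module.card_eq_pow_finrank (K := K) (V := V)]
  push_cast
  by_cases h₁ : finrank K S = r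
  · simp [h₁]
  · by_cases h₂ : finrank K S + 1 = r
    · subst h₂
      simp
      ring
    · simp [h₁, h₂]

open scoped Classical in
theorem rankCount_succ (k r : ℕ) :
    rankCount K V (k + 1) r =
      ∑ s : Fin k → V,
        ((if finrank K ↥(Submodule.span K (Set.range s)) = r then (Fintype.card K : ℤ) ^ r else 0) +
        (if finrank K ↥(Submodule.span K (Set.range s)) + 1 = r then
          (Fintype.card K : ℤ) ^ finrank K V - (Fintype.card K : ℤ) ^ (r - 1) else 0)) := by
  rw [rankCount, ← (Fin.consEquiv fun _ => V).sum_comp, Fintype.sum_prod_type_right]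
  refine Finset.sum_congr rfl fun s _ => ?_
  rw [← sum_ite_finrank_span_singleton_sup]
  refine Finset.sum_congr rfl fun x _ => ?_
  change (if finrank K ↥(Submodule.span K (Set.range (Fin.cons x s : Fin (k + 1) → V))) = r
    then _ else _) = _
  rw [Fin.range_cons, Submodule.span_insert]

theorem rankCount_succ_zero (k : ℕ) : rankCount K V (k + 1) 0 = rankCount K V k 0 := by
  rw [rankCount_succ, rankCount]
  simp only [pow_zero, Nat.add_one_ne_zero, if_false, add_zero]

theorem rankCount_succ_succ (k r : ℕ) :
    rankCount K V (k + 1) (r + 1) =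
      rankCount K V k (r + 1) * (Fintype.card K : ℤ) ^ (r + 1) +
      rankCount K V k r *
        ((Fintype.card K : ℤ) ^ finrank K V - (Fintype.card K : ℤ) ^ r) := by
  rw [rankCount_succ, rankCount, rankCount, Finset.sum_add_distrib, Finset.sum_mul,
    Finset.sum_mul]
  simp only [Nat.add_right_cancel_iff, Nat.add_sub_cancel, ite_mul, one_mul, zero_mul]

theorem prod_range_succ_pow_sub_pow {R : Type*} [CommRing R] (q : R) (k r : ℕ) :
    ∏ i ∈ Finset.range (r + 1), (q ^ (k + 1) - q ^ i) =
      (q ^ (k + 1) - 1) * q ^ r * ∏ i ∈ Finset.range r, (q ^ k - q ^ i) := by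
  have h : ∏ i ∈ Finset.range r, (q ^ (k + 1) - q ^ (i + 1)) =
      q ^ r * ∏ i ∈ Finset.range r, (q ^ k - q ^ i) := by
    rw [show q ^ r = ∏ _i ∈ Finset.range r, q by simp, ← Finset.prod_mul_distrib]
    exact Finset.prod_congr rfl fun i _ => by ring
  rw [Finset.prod_range_succ', h]
  ring

/-- Closed form for the number of tuples of given rank, with denominators cleared. -/
theorem rankCount_mul_prod (k r : ℕ) :
    rankCount K V k r * ∏ i ∈ Finset.range r, ((Fintype.card K : ℤ) ^ r - Fintype.card K ^ i) =
      (∏ i ∈ Finset.range r, ((Fintype.card K : ℤ) ^ finrank K V - Fintype.card K ^ i)) *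
      ∏ i ∈ Finset.range r, ((Fintype.card K : ℤ) ^ k - Fintype.card K ^ i) := by
  induction k generalizing r with
  | zero =>
    cases r with
    | zero => simp [rankCount_zero]
    | succ r => simp [rankCount_zero, Finset.prod_range_succ']
  | succ k ih =>
    cases r with
    | zero => simpa [rankCount_succ_zero] using ih 0
    | succ r =>
      have h₁ := ih (r + 1)
      have h₀ := ih r
      rw [rankCount_succ_succ, prod_range_succ_pow_sub_pow _ k r]
      rw [prod_range_succ_pow_sub_pow _ r r] at h₁ ⊢
      rw [Finset.prod_range_succ] at h₁ ⊢
      rw [Finset.prod_range_succ _ r] at h₁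
      linear_combination (Fintype.card K : ℤ) ^ (r + 1) * h₁ +
        ((Fintype.card K : ℤ) ^ finrank K V - (Fintype.card K : ℤ) ^ r) *
          ((Fintype.card K : ℤ) ^ (r + 1) - 1) * (Fintype.card K : ℤ) ^ r * h₀

end RankCount

theorem Matrix.card_rank_eq_rankCount {K : Type*} [Field K] [Fintype K] (k n r : ℕ) :
    (Nat.card {M : Matrix (Fin k) (Fin n) K // M.rank = r} : ℤ) =
      rankCount K (Fin n → K) k r := by
  classical
  rw [Nat.card_eq_fintype_card, Fintype.card_subtype, Finset.card_filter, rankCount]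
  push_cast
  refine Finset.sum_congr rfl fun M _ => ?_
  rw [Matrix.rank_eq_finrank_span_row]
  rfl

theorem prod_two_pow_sub_two_pow (m r : ℕ) :
    ∏ i ∈ Finset.range r, ((2 : ℝ) ^ (r + m) - 2 ^ i) =
      2 ^ ((r + m) * r) * ∏ k ∈ Finset.range r, (1 - ((2 : ℝ) ^ (m + (k + 1)))⁻¹) := by
  rw [← Finset.prod_range_reflect, pow_mul,
    show ((2 : ℝ) ^ (r + m)) ^ r = ∏ _i ∈ Finset.range r, (2 : ℝ) ^ (r + m) by simp,
    ← Finset.prod_mul_distrib]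
  refine Finset.prod_congr rfl fun j hj => ?_
  have hj := Finset.mem_range.1 hj
  have h : r + m = (r - 1 - j) + (m + (j + 1)) := by omega
  rw [h, pow_add _ _ (m + (j + 1))]
  have : (2 : ℝ) ^ (m + (j + 1)) ≠ 0 := by positivity
  field_simp

theorem summable_inv_two_pow_add (m : ℕ) :
    Summable fun k : ℕ => ‖-((2 : ℝ) ^ (m + (k + 1)))⁻¹‖ := by
  refine ((summable_geometric_two).mul_left ((2 : ℝ) ^ (m + 1))⁻¹).congr fun k => ?_
  rw [norm_neg, norm_inv, norm_pow, Real.norm_ofNat]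
  rw [show m + (k + 1) = m + 1 + k by ring, pow_add _ (m + 1) k, mul_inv, one_div, inv_pow]

theorem multipliable_one_sub_inv_two_pow (m : ℕ) :
    Multipliable fun k : ℕ => 1 - ((2 : ℝ) ^ (m + (k + 1)))⁻¹ := by
  simpa only [sub_eq_add_neg] using multipliable_one_add_of_summable (summable_inv_two_pow_add m)

theorem one_sub_inv_two_pow_ne_zero (m k : ℕ) : 1 - ((2 : ℝ) ^ (m + (k + 1)))⁻¹ ≠ 0 := by
  have : ((2 : ℝ) ^ (m + (k + 1)))⁻¹ < 1 :=
    inv_lt_one_of_one_lt₀ (one_lt_pow₀ (by norm_num) (by omega))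
  linarith

theorem tprod_one_sub_inv_two_pow_ne_zero (m : ℕ) :
    ∏' k : ℕ, (1 - ((2 : ℝ) ^ (m + (k + 1)))⁻¹) ≠ 0 := by
  have h := one_sub_inv_two_pow_ne_zero m
  simp only [sub_eq_add_neg] at h ⊢
  exact tprod_one_add_ne_zero_of_summable h (summable_inv_two_pow_add m)

/-- The probability of corank `m` at size `r + m`, in terms of partial products. -/
theorem card_rank_div_eq (m r : ℕ) :
    (Nat.card {M : Matrix (Fin (r + m)) (Fin (r + m)) (ZMod 2) // M.rank = r + m - m} : ℝ) /
        2 ^ ((r + m) * (r + m)) =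
      (∏ k ∈ Finset.range r, (1 - ((2 : ℝ) ^ (m + (k + 1)))⁻¹) ^ 2) /
        (2 ^ (m ^ 2) * ∏ k ∈ Finset.range r, (1 - ((2 : ℝ) ^ (0 + (k + 1)))⁻¹)) := by
  have h := rankCount_mul_prod (K := ZMod 2) (V := Fin (r + m) → ZMod 2) (r + m) r
  rw [← Matrix.card_rank_eq_rankCount, ZMod.card, Module.finrank_fin_fun] at h
  have h' := congrArg (Int.cast : ℤ → ℝ) h
  push_cast at h'
  have h₀ := prod_two_pow_sub_two_pow 0 r
  rw [add_zero] at h₀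
  rw [h₀, prod_two_pow_sub_two_pow m r] at h'
  have hne : ∏ k ∈ Finset.range r, (1 - ((2 : ℝ) ^ (0 + (k + 1)))⁻¹) ≠ 0 :=
    Finset.prod_ne_zero_iff.2 fun k _ => one_sub_inv_two_pow_ne_zero 0 k
  rw [Nat.add_sub_cancel, Finset.prod_pow, div_eq_div_iff (by positivity) (by positivity)]
  refine mul_left_cancel₀ (pow_ne_zero (r * r) (two_ne_zero (α := ℝ))) ?_
  linear_combination (2 : ℝ) ^ (m ^ 2) * h'

/-- For a uniformly random `n × n` matrix `M_n` over `F₂ = ZMod 2`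
and every fixed `m`, the probability that `M_n` has corank `m` (i.e. `rank M_n = n - m`)
converges, as `n → ∞`, to
`[∏_{k=1}^∞ (1 - 2^{-(m+k)})²] / [2^{m²} ∏_{k=1}^∞ (1 - 2^{-k})]`. -/
theorem corank_probability_limit (m : ℕ) :
    Tendsto
      (fun n : ℕ =>
        (Nat.card {M : Matrix (Fin n) (Fin n) (ZMod 2) // M.rank = n - m} : ℝ) /
          2 ^ (n * n))
      atTop
      (nhds ((∏' k : ℕ, (1 - ((2 : ℝ) ^ (m + (k + 1)))⁻¹) ^ 2) /
        (2 ^ (m ^ 2) * ∏' k : ℕ, (1 - ((2 : ℝ) ^ (k + 1))⁻¹)))) := by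
  rw [← tendsto_add_atTop_iff_nat m]
  simp only [card_rank_div_eq]
  have hm := multipliable_one_sub_inv_two_pow m
  have h₀ := multipliable_one_sub_inv_two_pow 0
  have hne := tprod_one_sub_inv_two_pow_ne_zero 0
  have hlim := (hm.pow 2).hasProd.tendsto_prod_nat.div
    (h₀.hasProd.tendsto_prod_nat.const_mul ((2 : ℝ) ^ (m ^ 2))) (by positivity)
  simpa only [zero_add, Pi.div_def] using hlim
end

section
/- (Proposition 2, stabilizer expurgation.) Let (S, G) be a stabilizer subsystem code on N qubits, and let g ∈ C(S) satisfy ω(g, h) = 0 for all h ∈ G. Set S' = S + span{g} and G' = G + span{g}, so that (S', G') is again a stabilizer subsystem code. Then for every probability distribution p on V (every Pauli error channel), the optimal maximum-likelihood recovery probability satisfies P_R(S', G', p) ≥ P_R(S, G, p): expurgating the logical operator g into the stabilizer group never decreases the recovery probability. -/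
/-- The `F₂`-vector space of `N`-qubit Pauli operators modulo phase:
`v = (x, z)` represents `∏ᵢ Xᵢ^{xᵢ} Zᵢ^{zᵢ}`. -/
abbrev PauliV (N : ℕ) := (Fin N → ZMod 2) × (Fin N → ZMod 2)

/-- The symplectic form `ω((x,z),(x',z')) = Σᵢ (xᵢ z'ᵢ + zᵢ x'ᵢ)`; it vanishes iff the
corresponding Pauli operators commute. -/
def omegaForm {N : ℕ} (v w : PauliV N) : ZMod 2 :=
  ∑ i, (v.1 i * w.2 i + v.2 i * w.1 i)

/-- The weight of a Pauli operator: the number of sites on which it acts nontrivially. -/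
def pauliWeight {N : ℕ} (v : PauliV N) : ℕ :=
  (Finset.univ.filter fun i => v.1 i ≠ 0 ∨ v.2 i ≠ 0).card

/-- The commutant `C(S) = {v : ω(v, s) = 0 for all s ∈ S}` of a subspace `S`. -/
def commutant {N : ℕ} (S : Submodule (ZMod 2) (PauliV N)) :
    Submodule (ZMod 2) (PauliV N) where
  carrier := {v | ∀ s ∈ S, omegaForm v s = 0}
  add_mem' := by
    intro a b ha hb s hs
    have h : omegaForm (a + b) s = omegaForm a s + omegaForm b s := by
      unfold omegaForm
      rw [← Finset.sum_add_distrib]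
      refine Finset.sum_congr rfl fun i _ => ?_
      simp only [Prod.fst_add, Prod.snd_add, Pi.add_apply]
      ring
    simp only [Set.mem_setOf_eq] at *
    rw [h, ha s hs, hb s hs, add_zero]
  zero_mem' := by
    intro s hs
    simp [omegaForm]
  smul_mem' := by
    intro c v hv s hs
    have h : omegaForm (c • v) s = c * omegaForm v s := by
      unfold omegaForm
      rw [Finset.mul_sum]
      refine Finset.sum_congr rfl fun i _ => ?_
      simp only [Prod.smul_fst, Prod.smul_snd, Pi.smul_apply, smul_eq_mul]
      ring
    simp only [Set.mem_setOf_eq] at *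
    rw [h, hv s hs, mul_zero]

/-- The code distance of a stabilizer subsystem code `(S, G)`: the minimal weight of an
element of `C(S)` not in `G` (a bare logical operator). -/
noncomputable def codeDistance {N : ℕ} (S G : Submodule (ZMod 2) (PauliV N)) : ℕ :=
  sInf {n | ∃ v, v ∈ commutant S ∧ v ∉ G ∧ pauliWeight v = n}

attribute [local instance] Classical.propDecidable

/-- The total probability `p(ℓ)` of the coset `ℓ = w + G` (a logical equivalence class). -/
noncomputable def cosetProb {N : ℕ} (G : Submodule (ZMod 2) (PauliV N))
    (p : PauliV N → ℝ) (w : PauliV N) : ℝ :=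
  ∑ u : PauliV N, if u - w ∈ G then p u else 0

/-- The optimal (maximum-likelihood) recovery probability
`P_R(S, G, p) = Σ_c max_{ℓ ⊆ c} p(ℓ)`, where `c` ranges over the cosets of `C(S)` in `V`
(syndrome classes) and `ℓ` over the cosets of `G` contained in `c` (logical classes). -/
noncomputable def recoveryProb {N : ℕ} (S G : Submodule (ZMod 2) (PauliV N))
    (p : PauliV N → ℝ) : ℝ :=
  ∑ᶠ c : PauliV N ⧸ commutant S,
    ⨆ w : {w : PauliV N // (Submodule.Quotient.mk w : PauliV N ⧸ commutant S) = c},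
      cosetProb G p w.1

theorem commutant_antitone {N : ℕ} {S T : Submodule (ZMod 2) (PauliV N)} (h : S ≤ T) :
    commutant T ≤ commutant S :=
  fun _ hv s hs => hv s (h hs)

theorem cosetProb_nonneg {N : ℕ} (G : Submodule (ZMod 2) (PauliV N))
    {p : PauliV N → ℝ} (hp : ∀ v, 0 ≤ p v) (w : PauliV N) : 0 ≤ cosetProb G p w :=
  Finset.sum_nonneg fun u _ => by split_ifs <;> simp [hp u]

theorem cosetProb_mono {N : ℕ} {G H : Submodule (ZMod 2) (PauliV N)} (h : G ≤ H)
    {p : PauliV N → ℝ} (hp : ∀ v, 0 ≤ p v) (w : PauliV N) :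
    cosetProb G p w ≤ cosetProb H p w := by
  refine Finset.sum_le_sum fun u _ => ?_
  by_cases hu : u - w ∈ G
  · simp [hu, h hu]
  · rw [if_neg hu]
    split_ifs <;> simp [hp u]

/-- Enlarging both subspaces of a pair `(S, G)` does not decrease the recovery probability:
the best representative of each class of `C(S)` lies in its own class of `C(T)`. -/
theorem recoveryProb_mono {N : ℕ} {S G T H : Submodule (ZMod 2) (PauliV N)}
    (hST : S ≤ T) (hGH : G ≤ H) {p : PauliV N → ℝ} (hp : ∀ v, 0 ≤ p v) :
    recoveryProb S G p ≤ recoveryProb T H p := by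
  have : Fintype (PauliV N ⧸ commutant S) := Fintype.ofFinite _
  have : Fintype (PauliV N ⧸ commutant T) := Fintype.ofFinite _
  have hmax (c : PauliV N ⧸ commutant S) :
      ∃ w : {w : PauliV N // (Submodule.Quotient.mk w : PauliV N ⧸ commutant S) = c},
        cosetProb G p w.1 = ⨆ w : {w : PauliV N //
          (Submodule.Quotient.mk w : PauliV N ⧸ commutant S) = c}, cosetProb G p w.1 := by
    obtain ⟨v, hv⟩ := Submodule.Quotient.mk_surjective _ c
    have : Nonempty {w : PauliV N //
      (Submodule.Quotient.mk w : PauliV N ⧸ commutant S) = c} := ⟨⟨v, hv⟩⟩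
    exact exists_eq_ciSup_of_finite
  choose w hw using hmax
  have hinj : Function.Injective fun c : PauliV N ⧸ commutant S =>
      (Submodule.Quotient.mk (w c).1 : PauliV N ⧸ commutant T) := by
    intro c d hcd
    rw [← (w c).2, ← (w d).2]
    exact (Submodule.Quotient.eq _).2
      (commutant_antitone hST ((Submodule.Quotient.eq _).1 hcd))
  unfold recoveryProb
  rw [finsum_eq_sum_of_fintype, finsum_eq_sum_of_fintype]
  let F : PauliV N ⧸ commutant T → ℝ := fun d =>
    ⨆ w : {w : PauliV N // (Submodule.Quotient.mk w : PauliV N ⧸ commutant T) = d},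
      cosetProb H p w.1
  calc
    _ ≤ ∑ c, F (Submodule.Quotient.mk (w c).1) := by
      refine Finset.sum_le_sum fun c _ => ?_
      rw [← hw c]
      exact (cosetProb_mono hGH hp _).trans
        (le_ciSup (f := fun v : {v : PauliV N //
          (Submodule.Quotient.mk v : PauliV N ⧸ commutant T) =
            Submodule.Quotient.mk (w c).1} => cosetProb H p v.1)
          (Set.finite_range _).bddAbove ⟨(w c).1, rfl⟩)
    _ = ∑ d ∈ Finset.univ.image fun c =>
          (Submodule.Quotient.mk (w c).1 : PauliV N ⧸ commutant T), F d :=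
      (Finset.sum_image hinj.injOn).symm
    _ ≤ ∑ d, F d :=
      Finset.sum_le_sum_of_subset_of_nonneg (Finset.subset_univ _) fun d _ _ =>
        Real.iSup_nonneg fun v => cosetProb_nonneg H hp v.1

/-- Proposition 2, stabilizer expurgation: if `(S, G)` is a stabilizer
subsystem code, `g ∈ C(S)` commutes with all of `G`, and `S' = S + span{g}`,
`G' = G + span{g}` (so `(S', G')` is again a stabilizer subsystem code), then for every
probability distribution `p` on `V` (every Pauli error channel) the optimal
maximum-likelihood recovery probability satisfies `P_R(S', G', p) ≥ P_R(S, G, p)`: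
expurgating the logical operator `g` into the stabilizer group never decreases the
recovery probability. -/
theorem stabilizer_expurgation_recovery (N : ℕ) (hN : 1 ≤ N)
    (S G : Submodule (ZMod 2) (PauliV N))
    (hSG : S ≤ G) (hGC : G ≤ commutant S)
    (g : PauliV N) (hg : g ∈ commutant S)
    (hcomm : ∀ h ∈ G, omegaForm g h = 0)
    (S' G' : Submodule (ZMod 2) (PauliV N))
    (hS' : S' = S ⊔ Submodule.span (ZMod 2) {g})
    (hG' : G' = G ⊔ Submodule.span (ZMod 2) {g})
    (p : PauliV N → ℝ) (hp0 : ∀ v, 0 ≤ p v) (hp1 : ∑ v : PauliV N, p v = 1) :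
    recoveryProb S G p ≤ recoveryProb S' G' p := by
  subst hS' hG'
  exact recoveryProb_mono le_sup_left le_sup_left hp0
end
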